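/- Let J be a finite nonempty index set, let g_j : ℝⁿ → ℝ be continuously differentiable for j ∈ J, let g(x) = max_{j∈J} g_j(x), and fix x ∈ ℝⁿ. Let J(x) = {j : g_j(x) = g(x)} be the active index set, let T = Tⁿ(x) be obtained from T⁰ = J(x) by the iterated coordinate-argmin procedure Tˡ = {t ∈ T^{l−1} : ⟨∇g_t(x), e_l⟩ = min_{s∈T^{l−1}} ⟨∇g_s(x), e_l⟩}, l = 1, …, n, and let Γ = {∇g_j(x) − ∇g_t(x) : j ∈ J(x) \ T, t ∈ T}. Then for every y ∈ ℝⁿ with ⟨α, y⟩ < 0 for all α ∈ Γ, and every t ∈ T, the one-sided directional derivative satisfies g′(x;y) = ⟨∇g_t(x), y⟩. -/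

import Mathlib

open scoped Classical RealInnerProductSpace
open Filter Topology

/-- One-sided directional derivative: `f′(x;y) = lim_{t↓0} (f(x+ty) − f(x))/t = d`. -/
def HasDirDeriv {n : ℕ} (f : EuclideanSpace ℝ (Fin n) → ℝ)
    (x y : EuclideanSpace ℝ (Fin n)) (d : ℝ) : Prop :=
  Tendsto (fun t : ℝ => (f (x + t • y) - f x) / t) (𝓝[>] (0 : ℝ)) (𝓝 d)

/-- Pointwise maximum of a finite family of functions. -/
noncomputable def fmax {n : ℕ} {J : Type*} [Fintype J] [Nonempty J]
    (f : J → EuclideanSpace ℝ (Fin n) → ℝ) (x : EuclideanSpace ℝ (Fin n)) : ℝ :=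
  Finset.univ.sup' Finset.univ_nonempty (fun j => f j x)

/-- The active index set `J(x) = {j ∈ J : f_j(x) = max_{i∈J} f_i(x)}`. -/
noncomputable def activeSet {n : ℕ} {J : Type*} [Fintype J] [Nonempty J]
    (f : J → EuclideanSpace ℝ (Fin n) → ℝ) (x : EuclideanSpace ℝ (Fin n)) : Finset J :=
  Finset.univ.filter (fun j => f j x = fmax f x)

/-- Iterated coordinate-argmin sets: `T⁰ = T0` and, for `l = 1, …, n`,
`Tˡ = {t ∈ T^{l−1} : ⟨v_t, e_l⟩ = min_{s ∈ T^{l−1}} ⟨v_s, e_l⟩}` (note that `⟨v, e_l⟩` is the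
`l`-th coordinate of `v`, i.e. coordinate `l - 1` in `Fin n`). -/
noncomputable def Titer {n : ℕ} {J : Type*} (v : J → EuclideanSpace ℝ (Fin n))
    (T0 : Finset J) : ℕ → Finset J
  | 0 => T0
  | l + 1 =>
    if h : l < n then
      (Titer v T0 l).filter fun t => ∀ s ∈ Titer v T0 l, v t ⟨l, h⟩ ≤ v s ⟨l, h⟩
    else Titer v T0 l

theorem Titer_subset {n : ℕ} {J : Type*} (v : J → EuclideanSpace ℝ (Fin n)) (T0 : Finset J)
    (k : ℕ) : Titer v T0 k ⊆ T0 := by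
  induction k with
  | zero => exact subset_rfl
  | succ k ih =>
    rw [Titer]
    split_ifs with h
    · exact (Finset.filter_subset _ _).trans ih
    · exact ih

/-- Members of the `k`-th iterated argmin set agree in their first `k` coordinates. -/
theorem apply_eq_of_mem_Titer {n : ℕ} {J : Type*} (v : J → EuclideanSpace ℝ (Fin n))
    (T0 : Finset J) (k : ℕ) {s t : J} (hs : s ∈ Titer v T0 k) (ht : t ∈ Titer v T0 k)
    (i : Fin n) (hi : (i : ℕ) < k) : v s i = v t i := by
  induction k with
  | zero => exact absurd hi (Nat.not_lt_zero _)
  | succ k ih =>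
    rw [Titer] at hs ht
    split_ifs at hs ht with h
    · rw [Finset.mem_filter] at hs ht
      rcases Nat.lt_succ_iff_lt_or_eq.mp hi with hik | rfl
      · exact ih hs.1 ht.1 hik
      · exact le_antisymm (hs.2 t ht.1) (ht.2 s hs.1)
    · exact ih hs ht (by omega)

/-- The full iterated argmin procedure leaves only one vector. -/
theorem eq_of_mem_Titer {n : ℕ} {J : Type*} (v : J → EuclideanSpace ℝ (Fin n))
    (T0 : Finset J) {s t : J} (hs : s ∈ Titer v T0 n) (ht : t ∈ Titer v T0 n) : v s = v t := by
  ext i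
  exact apply_eq_of_mem_Titer v T0 n hs ht i i.isLt

theorem DifferentiableAt.hasDirDeriv {n : ℕ} {f : EuclideanSpace ℝ (Fin n) → ℝ}
    {x : EuclideanSpace ℝ (Fin n)} (hf : DifferentiableAt ℝ f x)
    (y : EuclideanSpace ℝ (Fin n)) : HasDirDeriv f x y ⟪gradient f x, y⟫ := by
  have h := (hf.hasGradientAt.hasFDerivAt.hasLineDerivAt y).tendsto_slope_zero_right
  simpa [HasDirDeriv, div_eq_inv_mul] using h

theorem le_fmax {n : ℕ} {J : Type*} [Fintype J] [Nonempty J]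
    (f : J → EuclideanSpace ℝ (Fin n) → ℝ) (j : J) (x : EuclideanSpace ℝ (Fin n)) :
    f j x ≤ fmax f x :=
  Finset.le_sup' (fun j => f j x) (Finset.mem_univ j)

/-- A maximum of finitely many functions has directional derivative `d` if `d` is attained by an
active function and bounds the directional derivatives of all active functions. -/
theorem hasDirDeriv_fmax {n : ℕ} {J : Type*} [Fintype J] [Nonempty J]
    {f : J → EuclideanSpace ℝ (Fin n) → ℝ} {x y : EuclideanSpace ℝ (Fin n)} {d : J → ℝ}
    (hc : ∀ j, ContinuousAt (f j) x) (hd : ∀ j, HasDirDeriv (f j) x y (d j)) {t : J}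
    (ht : t ∈ activeSet f x) (hle : ∀ j ∈ activeSet f x, d j ≤ d t) :
    HasDirDeriv (fmax f) x y (d t) := by
  have hpos : ∀ᶠ s : ℝ in 𝓝[>] 0, 0 < s := eventually_mem_nhdsWithin
  refine tendsto_order.2 ⟨fun a ha => ?_, fun a ha => ?_⟩
  · filter_upwards [(hd t).eventually (lt_mem_nhds ha), hpos] with s hs hs0
    refine hs.trans_le ?_
    rw [(Finset.mem_filter.mp ht).2]
    gcongr
    exact le_fmax f t _
  · have key : ∀ j, ∀ᶠ s : ℝ in 𝓝[>] 0, f j (x + s • y) - fmax f x < a * s := by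
      intro j
      by_cases hj : j ∈ activeSet f x
      · filter_upwards [(hd j).eventually (gt_mem_nhds ((hle j hj).trans_lt ha)), hpos]
          with s hs hs0
        rwa [← (Finset.mem_filter.mp hj).2, ← div_lt_iff₀ hs0]
      · have hlt : f j x < fmax f x := lt_of_le_of_ne (le_fmax f j x)
          fun h => hj (Finset.mem_filter.mpr ⟨Finset.mem_univ j, h⟩)
        have hline : ContinuousAt (fun s : ℝ => f j (x + s • y)) 0 :=
          ContinuousAt.comp (f := fun s : ℝ => x + s • y) (by simpa using hc j) (by fun_prop)
        have hlim : ContinuousAt (fun s : ℝ => f j (x + s • y) - fmax f x) 0 :=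
          hline.sub continuousAt_const
        exact (hlim.eventually_lt (by fun_prop : ContinuousAt (fun s : ℝ => a * s) 0)
          (by simpa using hlt)).filter_mono nhdsWithin_le_nhds
    filter_upwards [eventually_all.2 key, hpos] with s hs hs0
    obtain ⟨j, -, hj⟩ := Finset.exists_mem_eq_sup' Finset.univ_nonempty
      (fun j => f j (x + s • y))
    rw [div_lt_iff₀ hs0, fmax, hj]
    exact hs j

/-- with `T = Tⁿ(x)` the iterated coordinate-argmin set of the active gradients
and `Γ = {∇g_j(x) − ∇g_t(x) : j ∈ J(x) \ T, t ∈ T}`, for every `y` with `⟨α, y⟩ < 0` for all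
`α ∈ Γ` and every `t ∈ T`, the directional derivative of `g = max_j g_j` satisfies
`g′(x;y) = ⟨∇g_t(x), y⟩`. -/
theorem dirDeriv_eq_grad_inner_on_cone {n : ℕ} {J : Type*} [Fintype J] [Nonempty J]
    (g : J → EuclideanSpace ℝ (Fin n) → ℝ) (hg : ∀ j, ContDiff ℝ 1 (g j))
    (x : EuclideanSpace ℝ (Fin n))
    (T : Finset J) (hT : T = Titer (fun j => gradient (g j) x) (activeSet g x) n)
    (y : EuclideanSpace ℝ (Fin n))
    (hy : ∀ j ∈ activeSet g x \ T, ∀ t ∈ T,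
      ⟪gradient (g j) x - gradient (g t) x, y⟫ < 0) :
    ∀ t ∈ T, HasDirDeriv (fmax g) x y ⟪gradient (g t) x, y⟫ := by
  intro t ht
  have hdiff (j : J) : DifferentiableAt ℝ (g j) x := (hg j).differentiable one_ne_zero x
  refine hasDirDeriv_fmax (d := fun j => ⟪gradient (g j) x, y⟫)
    (fun j => (hdiff j).continuousAt) (fun j => (hdiff j).hasDirDeriv y)
    (Titer_subset _ _ _ (hT ▸ ht)) fun j hj => ?_
  by_cases hjT : j ∈ T
  · have h := eq_of_mem_Titer (fun j => gradient (g j) x) (activeSet g x) (hT ▸ hjT) (hT ▸ ht)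
    exact (congrArg (fun w => ⟪w, y⟫) h).le
  · have h := hy j (Finset.mem_sdiff.mpr ⟨hj, hjT⟩) t ht
    rw [inner_sub_left] at h
    exact (sub_neg.mp h).le
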